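/- Fix an integer N ≥ 1 and positive reals a, b with a ≤ b, and for ρ > 0 define P(ρ) = Σ_{l=0}^{N} C(N,l) · (1 − e^{−2(b−a)/ρ})^l · e^{−3la/ρ} · (1 − e^{−3a/ρ})^{N−l}. Then ρ^N · P(ρ) → Σ_{l=0}^{N} C(N,l) · (2b − 2a)^l · (3a)^{N−l} = (a + 2b)^N as ρ → ∞. In particular P(ρ) decays like a constant times ρ^{−N}, i.e., the two-stage relay selection scheme achieves diversity gain N. -/

import Mathlib

open Filter

theorem key_limit (c d : ℝ) :
    Tendsto (fun ρ : ℝ => ρ * (1 - Real.exp (-c * (d / ρ)))) atTop (nhds (c * d)) := by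
  have h : HasDerivAt (fun x : ℝ => 1 - Real.exp (-c * (d * x))) (c * d) 0 := by
    have h1 : HasDerivAt (fun x : ℝ => -c * (d * x)) (-c * (d * 1)) 0 :=
      ((hasDerivAt_id (0 : ℝ)).const_mul d).const_mul (-c)
    have h2 := h1.exp.const_sub 1
    exact h2.congr_deriv (by simp)
  have h3 := (hasDerivAt_iff_tendsto_slope_zero.1 h)
  have h4 : Tendsto (fun ρ : ℝ => ρ⁻¹) atTop (nhdsWithin 0 {0}ᶜ) :=
    tendsto_inv_atTop_nhdsGT_zero.mono_right
      (nhdsWithin_mono _ (fun x hx => ne_of_gt hx))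
  refine (h3.comp h4).congr (fun ρ => ?_)
  simp [div_eq_mul_inv]

/-- Remark 1 of the paper, high-SNR diversity analysis: for the
two-stage outage probability `P(ρ)` of Lemma 1 with thresholds `ξ₁ = a/ρ` and
`ξ₂ = b/ρ` (`0 < a ≤ b`), one has
`ρ^N · P(ρ) → ∑_{l=0}^N C(N,l) (2b-2a)^l (3a)^{N-l} = (a+2b)^N` as `ρ → ∞`;
i.e., the two-stage relay selection scheme achieves diversity gain `N`. -/
theorem twoStage_diversity_gain
    (N : ℕ) (hN : 1 ≤ N) (a b : ℝ) (ha : 0 < a) (hb : 0 < b) (hab : a ≤ b) :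
    Tendsto (fun ρ : ℝ => ρ ^ N *
          ∑ l ∈ Finset.range (N + 1), (N.choose l : ℝ)
            * (1 - Real.exp (-2 * ((b - a) / ρ))) ^ l
            * Real.exp (-(3 * l) * (a / ρ))
            * (1 - Real.exp (-3 * (a / ρ))) ^ (N - l))
        atTop
        (nhds (∑ l ∈ Finset.range (N + 1), (N.choose l : ℝ)
          * (2 * b - 2 * a) ^ l * (3 * a) ^ (N - l))) ∧
      ∑ l ∈ Finset.range (N + 1), (N.choose l : ℝ)
          * (2 * b - 2 * a) ^ l * (3 * a) ^ (N - l)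
        = (a + 2 * b) ^ N := by
  constructor
  · simp_rw [Finset.mul_sum]
    refine tendsto_finsetSum _ (fun l hl => ?_)
    have hl' : l ≤ N := Nat.lt_succ_iff.1 (Finset.mem_range.1 hl)
    have h1 := (key_limit 2 (b - a)).pow l
    have h2 := (key_limit 3 a).pow (N - l)
    have h3 : Tendsto (fun ρ : ℝ => Real.exp (-(3 * l) * (a / ρ))) atTop (nhds 1) := by
      have h4 : Tendsto (fun ρ : ℝ => -(3 * (l : ℝ)) * (a / ρ)) atTop (nhds 0) := by
        simpa using (tendsto_const_nhds.div_atTop tendsto_id : Tendsto (fun ρ : ℝ => a / ρ)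
          atTop (nhds 0)).const_mul (-(3 * (l : ℝ)))
      simpa [Function.comp_def] using (Real.continuous_exp.tendsto 0).comp h4
    have h5 := ((h1.const_mul (N.choose l : ℝ)).mul h3).mul h2
    have e : (N.choose l : ℝ) * (2 * b - 2 * a) ^ l * (3 * a) ^ (N - l)
        = (N.choose l : ℝ) * (2 * (b - a)) ^ l * 1 * (3 * a) ^ (N - l) := by
      rw [mul_one, mul_sub]
    rw [e]
    refine h5.congr (fun ρ => ?_)
    have hp : ρ ^ N = ρ ^ l * ρ ^ (N - l) := by
      rw [← pow_add, Nat.add_sub_cancel' hl']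
    rw [hp, mul_pow, mul_pow]
    ring
  · have e : a + 2 * b = (2 * b - 2 * a) + 3 * a := by ring
    rw [e, add_pow]
    exact Finset.sum_congr rfl (fun l _ => by ring)
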